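/- arXiv:2604.07819 — 3 statements merged into one kernel-verified Lean document; each statement's English description precedes it below -/
import Mathlib

section
/- Let α > 0, ε > 0, and let m ≥ 1 be an integer. There exists a constant C, depending only on α, ε and m, such that for every r > 0 one has ∫_0^{r^α} s · ( ∫_{[0,r^α]^m} (u₁ + ⋯ + u_m + s)^{−(m+1)+ε/α} du )² ds ≤ C · r^{2ε}, where du denotes m-dimensional Lebesgue measure on the box [0,r^α]^m. -/
open MeasureTheory Set
open scoped ENNReal NNReal

noncomputable section

lemma integrableOn_add_rpow_Icc {s : ℝ} (hs : 0 < s) (R p : ℝ) :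
    IntegrableOn (fun x : ℝ => (x + s) ^ p) (Icc 0 R) := by
  refine ContinuousOn.integrableOn_compact isCompact_Icc fun x hx => ?_
  have : x + s ≠ 0 := by linarith [hx.1]
  exact ((continuousAt_id.add continuousAt_const).rpow_const (Or.inl this)).continuousWithinAt

lemma setIntegral_add_rpow_neg_le {s R p : ℝ} (hs : 0 < s) (hR : 0 ≤ R) (hp : 1 < p) :
    ∫ x in Icc 0 R, (x + s) ^ (-p) ≤ s ^ (1 - p) / (p - 1) := by
  rw [integral_Icc_eq_integral_Ioc, ← intervalIntegral.integral_of_le hR,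
    intervalIntegral.integral_comp_add_right (fun x => x ^ (-p)) s, integral_rpow]
  · have h1 : 0 ≤ (R + s) ^ (1 - p) := by positivity
    have h2 : -p + 1 = -(p - 1) := by ring
    have h3 : 0 < p - 1 := by linarith
    rw [h2, div_neg, ← neg_div, zero_add, show -(p - 1) = 1 - p by ring]
    gcongr
    linarith
  · right
    refine ⟨by linarith, fun h => ?_⟩
    rw [uIcc_of_le (by linarith)] at h
    linarith [h.1]

/-- A power of `∑ i, u i + s` with exponent `-(m p)` is dominated by the product of the
one-variable powers, so its integral over a box is at most the product of the integrals. -/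
lemma setIntegral_sum_add_rpow_neg_le {m : ℕ} {s R p q δ : ℝ} (hs : 0 < s) (hsR : s ≤ R)
    (hp : 1 < p) (hδ : 0 ≤ δ) (hq : q = -(m * p) + δ) :
    ∫ u in Icc (0 : Fin m → ℝ) (fun _ => R), ((∑ i, u i) + s) ^ q
      ≤ ((m + 1) * R) ^ δ * (s ^ (1 - p) / (p - 1)) ^ m := by
  have hR : 0 ≤ R := hs.le.trans hsR
  have hvol : (volume : Measure (Fin m → ℝ)).restrict (Icc 0 (fun _ => R))
      = Measure.pi fun _ => (volume : Measure ℝ).restrict (Icc 0 R) := by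
    rw [← pi_univ_Icc, volume_pi, Measure.restrict_pi_pi]
    rfl
  have h_integrable : Integrable (fun u : Fin m → ℝ => ((m + 1) * R) ^ δ * ∏ i, (u i + s) ^ (-p))
      ((volume : Measure (Fin m → ℝ)).restrict (Icc 0 (fun _ => R))) := by
    rw [hvol]
    exact (Integrable.fintype_prod fun _ => integrableOn_add_rpow_Icc hs R (-p)).const_mul _
  have hle : ∀ u ∈ Icc (0 : Fin m → ℝ) (fun _ => R),
      ((∑ i, u i) + s) ^ q ≤ ((m + 1) * R) ^ δ * ∏ i, (u i + s) ^ (-p) := by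
    intro u hu
    have hu0 : ∀ i, 0 ≤ u i := hu.1
    have hsum : 0 ≤ ∑ i, u i := Finset.sum_nonneg fun i _ => hu0 i
    have hsumR : ∑ i, u i ≤ m * R := by
      simpa using Finset.sum_le_sum fun i (_ : i ∈ Finset.univ) => hu.2 i
    have hpos : 0 < (∑ i, u i) + s := by linarith
    have hprod : ((∑ i, u i) + s) ^ (-(m * p)) ≤ ∏ i, (u i + s) ^ (-p) := by
      have : ((∑ i, u i) + s) ^ (-(m * p)) = ∏ _i : Fin m, ((∑ i, u i) + s) ^ (-p) := by
        rw [Finset.prod_const, Finset.card_univ, Fintype.card_fin, ← Real.rpow_mul_natCast hpos.le]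
        congr 1
        ring
      rw [this]
      refine Finset.prod_le_prod (fun _ _ => by positivity) fun i _ => ?_
      refine Real.rpow_le_rpow_of_nonpos (by linarith [hu0 i]) ?_ (by linarith)
      gcongr
      exact Finset.single_le_sum (fun j _ => hu0 j) (Finset.mem_univ i)
    rw [hq, Real.rpow_add hpos, mul_comm]
    gcongr
    linarith
  calc ∫ u in Icc (0 : Fin m → ℝ) (fun _ => R), ((∑ i, u i) + s) ^ q
      ≤ ∫ u in Icc (0 : Fin m → ℝ) (fun _ => R),
          ((m + 1) * R) ^ δ * ∏ i, (u i + s) ^ (-p) := by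
        refine integral_mono_of_nonneg ?_ h_integrable ?_
        · filter_upwards [ae_restrict_mem measurableSet_Icc] with u hu
          have hsum : 0 ≤ ∑ i, u i := Finset.sum_nonneg fun i _ => hu.1 i
          exact Real.rpow_nonneg (by linarith) _
        · filter_upwards [ae_restrict_mem measurableSet_Icc] with u hu using hle u hu
    _ = ((m + 1) * R) ^ δ * (∫ x in Icc 0 R, (x + s) ^ (-p)) ^ m := by
        rw [hvol, integral_const_mul,
          integral_fintype_prod_eq_prod (fun (_ : Fin m) (x : ℝ) => (x + s) ^ (-p))]
        simp
    _ ≤ ((m + 1) * R) ^ δ * (s ^ (1 - p) / (p - 1)) ^ m := by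
        gcongr
        · refine setIntegral_nonneg measurableSet_Icc fun x hx => ?_
          exact Real.rpow_nonneg (by linarith [hx.1]) _
        · exact setIntegral_add_rpow_neg_le hs hR hp

lemma setLIntegral_const_mul_rpow {R K a : ℝ} (hR : 0 ≤ R) (hK : 0 ≤ K) (ha : 0 < a) :
    ∫⁻ s in Ioc 0 R, ENNReal.ofReal (K * s ^ (a - 1)) = ENNReal.ofReal (K * (R ^ a / a)) := by
  have hi : IntervalIntegrable (fun s : ℝ => K * s ^ (a - 1)) volume 0 R :=
    (intervalIntegral.intervalIntegrable_rpow' (by linarith)).const_mul K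
  rw [← ofReal_integral_eq_lintegral_ofReal, ← intervalIntegral.integral_of_le hR,
    intervalIntegral.integral_const_mul, integral_rpow (Or.inl (by linarith))]
  · simp [Real.zero_rpow ha.ne']
  · exact (intervalIntegrable_iff_integrableOn_Ioc_of_le hR).1 hi
  · filter_upwards [ae_restrict_mem measurableSet_Ioc] with s hs
    have := hs.1
    positivity

theorem statement14 (α ε : ℝ) (hα : 0 < α) (hε : 0 < ε) (m : ℕ) (hm : 1 ≤ m) :
    ∃ C : ℝ, 0 < C ∧
      ∀ r : ℝ, 0 < r →
        (∫⁻ s in Ioc (0 : ℝ) (r ^ α),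
            ENNReal.ofReal (s *
              (∫ u in Icc (0 : Fin m → ℝ) (fun _ => r ^ α),
                ((∑ i, u i) + s) ^ (-((m : ℝ) + 1) + ε / α)) ^ 2))
          ≤ ENNReal.ofReal (C * r ^ (2 * ε)) := by
  obtain ⟨d, hd0, hd1, hdδ⟩ : ∃ d : ℝ, 0 < d ∧ d < 1 ∧ d ≤ ε / α :=
    ⟨min (1 / 2) (ε / α), by positivity, (min_le_left _ _).trans_lt (by norm_num),
      min_le_right _ _⟩
  have hm0 : (0 : ℝ) < m := by exact_mod_cast hm
  obtain ⟨p, hp, hmp⟩ : ∃ p : ℝ, 1 < p ∧ m * p = m + 1 - d :=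
    ⟨(m + 1 - d) / m, by rw [lt_div_iff₀ hm0]; linarith, by field_simp⟩
  have hp0 : 0 < p - 1 := by linarith
  set A : ℝ := (m + 1) ^ (ε / α - d) / (p - 1) ^ m with hA
  have hA0 : 0 < A := by positivity
  refine ⟨A ^ 2 / (2 * d), by positivity, fun r hr => ?_⟩
  have hrε : r ^ (2 * ε) = (r ^ α) ^ (2 * (ε / α)) := by
    rw [← Real.rpow_mul hr.le]
    congr 1
    field_simp
  rw [hrε]
  have hR : 0 < r ^ α := by positivity
  generalize r ^ α = R at hR ⊢
  calc _ ≤ ∫⁻ s in Ioc 0 R,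
        ENNReal.ofReal ((A * R ^ (ε / α - d)) ^ 2 * s ^ (2 * d - 1)) := by
        refine setLIntegral_mono' measurableSet_Ioc fun s hs => ENNReal.ofReal_le_ofReal ?_
        have hs0 : 0 < s := hs.1
        have hI := setIntegral_sum_add_rpow_neg_le (m := m) (q := -((m : ℝ) + 1) + ε / α)
          hs0 hs.2 hp (sub_nonneg.2 hdδ) (by rw [hmp]; ring)
        have hI0 : 0 ≤ ∫ u in Icc (0 : Fin m → ℝ) (fun _ => R),
            ((∑ i, u i) + s) ^ (-((m : ℝ) + 1) + ε / α) := by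
          refine setIntegral_nonneg measurableSet_Icc fun u hu => ?_
          have hsum : 0 ≤ ∑ i, u i := Finset.sum_nonneg fun i _ => hu.1 i
          exact Real.rpow_nonneg (by linarith) _
        have hbound : ((m + 1) * R) ^ (ε / α - d) * (s ^ (1 - p) / (p - 1)) ^ m
            = A * R ^ (ε / α - d) * s ^ (d - 1) := by
          rw [div_pow, ← Real.rpow_mul_natCast hs0.le, Real.mul_rpow (by positivity) hR.le,
            show (1 - p) * m = d - 1 by linarith, hA]
          ring
        rw [hbound] at hI
        calc _ ≤ s * (A * R ^ (ε / α - d) * s ^ (d - 1)) ^ 2 := by gcongr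
          _ = (A * R ^ (ε / α - d)) ^ 2 * (s * (s ^ (d - 1)) ^ 2) := by ring
          _ = _ := by
            congr 1
            rw [← Real.rpow_mul_natCast hs0.le]
            nth_rewrite 1 [← Real.rpow_one s]
            rw [← Real.rpow_add hs0]
            congr 1
            push_cast
            ring
    _ = ENNReal.ofReal ((A * R ^ (ε / α - d)) ^ 2 * (R ^ (2 * d) / (2 * d))) :=
        setLIntegral_const_mul_rpow hR.le (by positivity) (by positivity)
    _ = ENNReal.ofReal (A ^ 2 / (2 * d) * R ^ (2 * (ε / α))) := by
        have : R ^ (2 * (ε / α)) = (R ^ (ε / α - d)) ^ 2 * R ^ (2 * d) := by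
          rw [← Real.rpow_mul_natCast hR.le, ← Real.rpow_add hR]
          congr 1
          push_cast
          ring
        rw [this]
        congr 1
        ring
end
end

section
/- There exists a constant C, depending only on n, α, ε and m, such that for every r > 0 one has ∑_{k=2}^{∞} 2^{kn} ∫_{r^α}^{(2^k r)^α} s · ( ∫_{[0,r^α]^m} G_k(u,s) du )² ds ≤ C. -/
open MeasureTheory Set
open scoped ENNReal NNReal

noncomputable section

/-- The auxiliary function `G_k(u, τ)`. -/
def Gfun (n m : ℕ) (α ε r : ℝ) (k : ℕ) (u : Fin m → ℝ) (τ : ℝ) : ℝ :=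
  ((∑ i, u i) + τ) ^ (-((m : ℝ) + 1))
    * max ((r / ((∑ i, u i) + τ) ^ (1 / α)) ^ ((n : ℝ) / 2))
          ((r / ((∑ i, u i) + τ) ^ (1 / α)) ^ (n : ℝ))
    * (1 + ((∑ i, u i) + τ) ^ (1 / α) / ((2 : ℝ) ^ k * r)) ^ ((n : ℝ) / 2)
    * (1 + (2 : ℝ) ^ k * r / ((∑ i, u i) + τ) ^ (1 / α)) ^ (-(n : ℝ) - ε)

/-- Pointwise bound for `G_k` on the domain of integration. -/
lemma norm_Gfun_le (n m : ℕ) {α ε r : ℝ} (hα : 0 < α) (hε : 0 < ε) (hr : 0 < r) (k : ℕ)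
    {s : ℝ} (hs : s ∈ Ioc (r ^ α) (((2 : ℝ) ^ k * r) ^ α))
    {u : Fin m → ℝ} (hu : u ∈ Icc (0 : Fin m → ℝ) (fun _ => r ^ α)) :
    ‖Gfun n m α ε r k u s‖ ≤
      s ^ (-((m : ℝ) + 1)) * (r / s ^ (1 / α)) ^ ((n : ℝ) / 2)
        * (1 + ((m : ℝ) + 1) ^ (1 / α)) ^ ((n : ℝ) / 2)
        * ((2 : ℝ) ^ k * r / (((m : ℝ) + 1) ^ (1 / α) * s ^ (1 / α))) ^ (-(n : ℝ) - ε) := by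
  have hrα : 0 < r ^ α := Real.rpow_pos_of_pos hr α
  have hs0 : 0 < s := hrα.trans hs.1
  have hM : (0 : ℝ) < 2 ^ k := by positivity
  have hu0 : 0 ≤ ∑ i, u i := Finset.sum_nonneg fun i _ => hu.1 i
  have hum : ∑ i, u i ≤ m * r ^ α := by
    have := Finset.sum_le_sum fun i (_ : i ∈ Finset.univ) => hu.2 i
    simpa using this
  unfold Gfun
  set T := (∑ i, u i) + s with hT
  have hsT : s ≤ T := by linarith
  have hTs : T ≤ (m + 1) * s := by
    have : (m : ℝ) * r ^ α ≤ m * s := by gcongr; exact hs.1.le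
    linarith
  have hT0 : 0 < T := hs0.trans_le hsT
  have hα' : 0 ≤ 1 / α := by positivity
  set A := ((m : ℝ) + 1) ^ (1 / α) with hA
  have hA0 : 0 < A := by positivity
  have hSt : s ^ (1 / α) ≤ T ^ (1 / α) := Real.rpow_le_rpow hs0.le hsT hα'
  have htS : T ^ (1 / α) ≤ A * s ^ (1 / α) := by
    rw [hA, ← Real.mul_rpow (by positivity) hs0.le]
    exact Real.rpow_le_rpow hT0.le hTs hα'
  have hrS : r ≤ s ^ (1 / α) := by
    rw [one_div, Real.le_rpow_inv_iff_of_pos hr.le hs0.le hα]; exact hs.1.le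
  have hSM : s ^ (1 / α) ≤ 2 ^ k * r := by
    rw [one_div, Real.rpow_inv_le_iff_of_pos hs0.le (by positivity) hα]; exact hs.2
  set t := T ^ (1 / α)
  set S := s ^ (1 / α)
  have hS0 : 0 < S := hr.trans_le hrS
  have ht0 : 0 < t := hS0.trans_le hSt
  have hrt : r / t ≤ r / S := by gcongr
  have hrt1 : r / t ≤ 1 := (div_le_one ht0).2 (hrS.trans hSt)
  have hn0 : (0 : ℝ) ≤ n := n.cast_nonneg
  rw [Real.norm_of_nonneg (by positivity)]
  gcongr ?_ * ?_ * ?_ * ?_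
  · exact Real.rpow_le_rpow_of_nonpos hs0 hsT (by linarith [(Nat.cast_nonneg m : (0 : ℝ) ≤ m)])
  · have h1 : (r / t) ^ ((n : ℝ) / 2) ≤ (r / S) ^ ((n : ℝ) / 2) := by gcongr
    exact max_le h1 ((Real.rpow_le_rpow_of_exponent_ge (by positivity) hrt1 (by linarith)).trans h1)
  · gcongr
    rw [div_le_iff₀ (by positivity)]
    exact htS.trans (by gcongr)
  · refine Real.rpow_le_rpow_of_nonpos (by positivity) ?_ (by linarith)
    have : (2 : ℝ) ^ k * r / (A * S) ≤ 2 ^ k * r / t := by gcongr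
    linarith

/-- Rearrangement of a product of powers, losing all but an eighth of a power of `r ^ α / s`. -/
lemma mul_rpow_rearrange {n m : ℕ} (hm : 1 ≤ m) {α ε r s M A B : ℝ} (hα : 0 < α) (hr : 0 < r)
    (hs : r ^ α < s) (hM : 0 < M) (hA : 0 < A) (hB : 0 ≤ B) :
    s ^ (-((m : ℝ) + 1)) * (r / s ^ (1 / α)) ^ ((n : ℝ) / 2) * B
        * (M * r / (A * s ^ (1 / α))) ^ (-(n : ℝ) - ε) * (r ^ α) ^ m
      ≤ B * A ^ (n + ε) * (s ^ ((n / 2 + ε - α / 8) / α - 1) * r ^ (-(n / 2 + ε - α / 8))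
        * M ^ (-(n : ℝ) - ε)) := by
  have hs0 : 0 < s := (Real.rpow_pos_of_pos hr α).trans hs
  have hlog : α * Real.log r ≤ Real.log s := by
    rw [← Real.log_rpow hr]; exact Real.log_le_log (by positivity) hs.le
  have key : s ^ (-((m : ℝ) + 1)) * (r / s ^ (1 / α)) ^ ((n : ℝ) / 2)
        * (M * r / (A * s ^ (1 / α))) ^ (-(n : ℝ) - ε) * (r ^ α) ^ m
      ≤ A ^ (n + ε) * (s ^ ((n / 2 + ε - α / 8) / α - 1) * r ^ (-(n / 2 + ε - α / 8))
        * M ^ (-(n : ℝ) - ε)) := by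
    rw [← Real.log_le_log_iff (by positivity) (by positivity), ← Real.rpow_natCast]
    rw [Real.log_mul (by positivity) (by positivity), Real.log_mul (by positivity) (by positivity),
      Real.log_mul (by positivity) (by positivity), Real.log_mul (by positivity) (by positivity),
      Real.log_mul (by positivity) (by positivity), Real.log_mul (by positivity) (by positivity),
      Real.log_rpow (by positivity), Real.log_rpow (by positivity), Real.log_rpow (by positivity),
      Real.log_rpow (by positivity), Real.log_rpow (by positivity), Real.log_rpow (by positivity),
      Real.log_rpow (by positivity), Real.log_rpow (by positivity),
      Real.log_div (by positivity) (by positivity), Real.log_div (by positivity) (by positivity),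
      Real.log_mul (by positivity) (by positivity), Real.log_mul (by positivity) (by positivity),
      Real.log_rpow (by positivity)]
    have hm' : (1 : ℝ) ≤ m := by exact_mod_cast hm
    have h := mul_nonneg (by linarith : (0 : ℝ) ≤ m - 1 / 8) (sub_nonneg.2 hlog)
    rw [← sub_nonneg]
    refine h.trans_eq ?_
    rw [Real.log_rpow hM]
    field_simp
    ring
  calc _ = B * (s ^ (-((m : ℝ) + 1)) * (r / s ^ (1 / α)) ^ ((n : ℝ) / 2)
        * (M * r / (A * s ^ (1 / α))) ^ (-(n : ℝ) - ε) * (r ^ α) ^ m) := by ring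
    _ ≤ _ := by rw [mul_assoc B]; gcongr

lemma lintegral_Ioc_rpow_sub_one_le {p a b : ℝ} (hp : 0 < p) (ha : 0 ≤ a) (hab : a ≤ b) :
    ∫⁻ s in Ioc a b, ENNReal.ofReal (s ^ (p - 1)) ≤ ENNReal.ofReal (b ^ p / p) := by
  have hb : 0 ≤ b := ha.trans hab
  have hint : IntervalIntegrable (fun s : ℝ => s ^ (p - 1)) volume 0 b :=
    intervalIntegral.intervalIntegrable_rpow' (by linarith)
  calc ∫⁻ s in Ioc a b, ENNReal.ofReal (s ^ (p - 1))
      ≤ ∫⁻ s in Ioc 0 b, ENNReal.ofReal (s ^ (p - 1)) :=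
        lintegral_mono_set (Ioc_subset_Ioc_left ha)
    _ = ENNReal.ofReal (∫ s in Ioc 0 b, s ^ (p - 1)) := by
        refine (ofReal_integral_eq_lintegral_ofReal
          ((intervalIntegrable_iff_integrableOn_Ioc_of_le hb).1 hint) ?_).symm
        filter_upwards [ae_restrict_mem measurableSet_Ioc] with s hs
        exact Real.rpow_nonneg hs.1.le _
    _ ≤ ENNReal.ofReal (b ^ p / p) := by
        rw [← intervalIntegral.integral_of_le hb, integral_rpow (Or.inl (by linarith))]
        simp [Real.zero_rpow hp.ne']

/-- Each summand is bounded by a term of a geometric sequence. -/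
lemma lintegral_Gfun_le {n m : ℕ} (hn : 1 ≤ n) (hm : 1 ≤ m) {α ε r : ℝ} (hα : 0 < α)
    (hα2 : α < 2) (hε : 0 < ε) (hr : 0 < r) (k : ℕ) :
    (2 : ℝ≥0∞) ^ (k * n) * ∫⁻ s in Ioc (r ^ α) (((2 : ℝ) ^ k * r) ^ α),
        ENNReal.ofReal (s *
          (∫ u in Icc (0 : Fin m → ℝ) (fun _ => r ^ α), Gfun n m α ε r k u s) ^ 2)
      ≤ ENNReal.ofReal (((1 + ((m : ℝ) + 1) ^ (1 / α)) ^ ((n : ℝ) / 2)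
          * (((m : ℝ) + 1) ^ (1 / α)) ^ (n + ε)) ^ 2 / (2 * (n / 2 + ε - α / 8) / α)
          * ((2 : ℝ) ^ (-(α / 4))) ^ k) := by
  set A := ((m : ℝ) + 1) ^ (1 / α)
  have hA : 0 < A := by positivity
  set K := (1 + A) ^ ((n : ℝ) / 2) * A ^ (n + ε) with hK
  have hK0 : 0 < K := by positivity
  set q := (n : ℝ) / 2 + ε - α / 8 with hq
  have hq0 : 0 < q := by
    have : (1 : ℝ) ≤ n := by exact_mod_cast hn
    linarith
  set M : ℝ := 2 ^ k with hMdef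
  have hM1 : 1 ≤ M := one_le_pow₀ (by norm_num)
  have hM : 0 < M := by positivity
  have hrα : 0 < r ^ α := Real.rpow_pos_of_pos hr α
  have hpoint : ∀ s ∈ Ioc (r ^ α) ((M * r) ^ α),
      s * (∫ u in Icc (0 : Fin m → ℝ) (fun _ => r ^ α), Gfun n m α ε r k u s) ^ 2
        ≤ (K * (r ^ (-q) * M ^ (-(n : ℝ) - ε))) ^ 2 * s ^ (2 * q / α - 1) := by
    intro s hs
    have hs0 : 0 < s := hrα.trans hs.1
    have hI := norm_setIntegral_le_of_norm_le_const (μ := volume)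
      (s := Icc (0 : Fin m → ℝ) (fun _ => r ^ α))
      (isCompact_Icc.measure_lt_top) (fun u hu => norm_Gfun_le n m hα hε hr k hs hu)
    have hvol : volume.real (Icc (0 : Fin m → ℝ) (fun _ => r ^ α)) = (r ^ α) ^ m := by
      rw [Measure.real, Real.volume_Icc_pi_toReal (a := 0) (fun _ => hrα.le)]
      simp
    rw [hvol] at hI
    have hI' := hI.trans (mul_rpow_rearrange hm hα hr hs.1 hM hA (by positivity))
    rw [← sq_abs, ← Real.norm_eq_abs]
    calc s * ‖∫ u in Icc (0 : Fin m → ℝ) (fun _ => r ^ α), Gfun n m α ε r k u s‖ ^ 2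
        ≤ s * (K * (s ^ (q / α - 1) * r ^ (-q) * M ^ (-(n : ℝ) - ε))) ^ 2 := by gcongr
      _ = (K * (r ^ (-q) * M ^ (-(n : ℝ) - ε))) ^ 2 * (s ^ (1 : ℝ) * (s ^ (q / α - 1)) ^ 2) := by
          rw [Real.rpow_one]; ring
      _ = _ := by
          rw [← Real.rpow_mul_natCast hs0.le, ← Real.rpow_add hs0]
          congr 2
          push_cast
          ring
  have hle : r ^ α ≤ (M * r) ^ α := by
    gcongr
    exact le_mul_of_one_le_left hr.le hM1
  have h2 : (2 : ℝ≥0∞) ^ (k * n) = ENNReal.ofReal (M ^ (n : ℝ)) := by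
    rw [Real.rpow_natCast, hMdef, ← pow_mul, ENNReal.ofReal_pow (by norm_num)]
    norm_num
  calc _ ≤ ENNReal.ofReal (M ^ (n : ℝ)) * ∫⁻ s in Ioc (r ^ α) ((M * r) ^ α),
        ENNReal.ofReal ((K * (r ^ (-q) * M ^ (-(n : ℝ) - ε))) ^ 2)
          * ENNReal.ofReal (s ^ (2 * q / α - 1)) := by
        rw [h2]
        refine mul_le_mul_right ?_ _
        refine setLIntegral_mono' measurableSet_Ioc fun s hs => ?_
        rw [← ENNReal.ofReal_mul (by positivity)]
        exact ENNReal.ofReal_le_ofReal (hpoint s hs)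
    _ ≤ ENNReal.ofReal (M ^ (n : ℝ)) * (ENNReal.ofReal ((K * (r ^ (-q) * M ^ (-(n : ℝ) - ε))) ^ 2)
          * ENNReal.ofReal (((M * r) ^ α) ^ (2 * q / α) / (2 * q / α))) := by
        rw [lintegral_const_mul' _ _ ENNReal.ofReal_ne_top]
        gcongr
        exact lintegral_Ioc_rpow_sub_one_le (by positivity) hrα.le hle
    _ = _ := by
        rw [← ENNReal.ofReal_mul (by positivity), ← ENNReal.ofReal_mul (by positivity)]
        congr 1
        have e1 : ((M * r) ^ α) ^ (2 * q / α) = M ^ (2 * q) * r ^ (2 * q) := by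
          rw [← Real.rpow_mul (by positivity), mul_div_cancel₀ _ hα.ne',
            Real.mul_rpow hM.le hr.le]
        have e2 : ((2 : ℝ) ^ (-(α / 4))) ^ k = M ^ (-(α / 4)) := by
          rw [hMdef, ← Real.rpow_natCast, ← Real.rpow_natCast, ← Real.rpow_mul (by norm_num),
            ← Real.rpow_mul (by norm_num), mul_comm]
        have e3 : (r ^ (-q)) ^ 2 * r ^ (2 * q) = 1 := by
          rw [← Real.rpow_mul_natCast hr.le, ← Real.rpow_add hr]
          norm_num
          rw [show -(q * 2) + 2 * q = 0 by ring, Real.rpow_zero]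
        have e4 : M ^ (n : ℝ) * (M ^ (-(n : ℝ) - ε)) ^ 2 * M ^ (2 * q) = M ^ (-(α / 4)) := by
          rw [← Real.rpow_mul_natCast hM.le, ← Real.rpow_add hM, ← Real.rpow_add hM]
          congr 1
          rw [hq]
          push_cast
          ring
        rw [e1, e2, ← e4]
        calc _ = K ^ 2 / (2 * q / α) * (M ^ (n : ℝ) * (M ^ (-(n : ℝ) - ε)) ^ 2 * M ^ (2 * q))
              * ((r ^ (-q)) ^ 2 * r ^ (2 * q)) := by ring
          _ = _ := by rw [e3, mul_one]

theorem statement16 (n : ℕ) (hn : 1 ≤ n) (α ε : ℝ) (hα : 0 < α) (hα2 : α < 2) (hε : 0 < ε)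
    (m : ℕ) (hm : 1 ≤ m) :
    ∃ C : ℝ, 0 < C ∧
      ∀ r : ℝ, 0 < r →
        (∑' k : ℕ, (2 : ℝ≥0∞) ^ ((k + 2) * n) *
            ∫⁻ s in Ioc (r ^ α) (((2 : ℝ) ^ (k + 2) * r) ^ α),
              ENNReal.ofReal (s *
                (∫ u in Icc (0 : Fin m → ℝ) (fun _ => r ^ α), Gfun n m α ε r (k + 2) u s) ^ 2))
          ≤ ENNReal.ofReal C := by
  set K := ((1 + ((m : ℝ) + 1) ^ (1 / α)) ^ ((n : ℝ) / 2)
          * (((m : ℝ) + 1) ^ (1 / α)) ^ (n + ε)) ^ 2 / (2 * (n / 2 + ε - α / 8) / α) with hK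
  set θ := (2 : ℝ) ^ (-(α / 4)) with hθ
  have hK0 : 0 < K := by
    have : (1 : ℝ) ≤ n := by exact_mod_cast hn
    have : 0 < (n : ℝ) / 2 + ε - α / 8 := by linarith
    positivity
  have hθ0 : 0 < θ := by positivity
  have hθ1 : θ < 1 := Real.rpow_lt_one_of_one_lt_of_neg (by norm_num) (by linarith)
  have hsum : Summable fun k : ℕ => K * θ ^ (k + 2) :=
    ((summable_nat_add_iff 2).2 (summable_geometric_of_lt_one hθ0.le hθ1)).mul_left K
  refine ⟨∑' k : ℕ, K * θ ^ (k + 2), hsum.tsum_pos (fun k => by positivity) 0 (by positivity),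
    fun r hr => ?_⟩
  rw [ENNReal.ofReal_tsum_of_nonneg (fun k => by positivity) hsum]
  exact ENNReal.tsum_le_tsum fun k => lintegral_Gfun_le hn hm hα hα2 hε hr (k + 2)
end
end

section
/- There exists a constant C, depending only on n, α, ε and m, such that for every r > 0 one has ∑_{k=2}^{∞} 2^{kn/2} ∫_{r^α}^{(2^k r)^α} ∫_{[0,r^α]^m} G_k(u,t) du dt ≤ C. -/
open MeasureTheory Set
open scoped ENNReal NNReal

noncomputable section

/-- For `r ≤ y ≤ B N r`, the product of the three scale factors decays like
`N ^ (-(n / 2 + δ))`, at the cost of a factor `(y / r) ^ δ`. -/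
lemma scale_factors_le {p ε δ r y N B : ℝ} (hp : 0 ≤ p) (hε : 0 < ε) (hδ0 : 0 ≤ δ)
    (hδ : δ ≤ p / 2) (hr : 0 < r) (hN : 0 < N) (hy : r ≤ y) (hyB : y ≤ B * (N * r)) :
    max ((r / y) ^ (p / 2)) ((r / y) ^ p) * (1 + y / (N * r)) ^ (p / 2)
        * (1 + N * r / y) ^ (-p - ε)
      ≤ (1 + B) ^ (p / 2) * N ^ (-(p / 2 + δ)) * r ^ (-δ) * y ^ δ := by
  have hy0 : 0 < y := hr.trans_le hy
  have hmax : max ((r / y) ^ (p / 2)) ((r / y) ^ p) = (r / y) ^ (p / 2) := by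
    refine max_eq_left (Real.rpow_le_rpow_of_exponent_ge (by positivity) ?_ (by linarith))
    exact (div_le_one hy0).2 hy
  have hmid : (1 + y / (N * r)) ^ (p / 2) ≤ (1 + B) ^ (p / 2) := by
    refine Real.rpow_le_rpow (by positivity) ?_ (by linarith)
    have : y / (N * r) ≤ B := (div_le_iff₀ (by positivity)).2 hyB
    linarith
  have hlast : (1 + N * r / y) ^ (-p - ε) ≤ (N * r / y) ^ (-(p / 2 + δ)) := by
    have hq : 0 < N * r / y := by positivity
    calc (1 + N * r / y) ^ (-p - ε) ≤ (1 + N * r / y) ^ (-(p / 2 + δ)) :=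
          Real.rpow_le_rpow_of_exponent_le (by linarith) (by linarith)
      _ ≤ _ := Real.rpow_le_rpow_of_nonpos hq (by linarith) (by linarith)
  have hprod : (r / y) ^ (p / 2) * (N * r / y) ^ (-(p / 2 + δ))
      = N ^ (-(p / 2 + δ)) * r ^ (-δ) * y ^ δ := by
    have hq : 0 < r / y := by positivity
    rw [mul_div_assoc, Real.mul_rpow hN.le hq.le, mul_left_comm, ← Real.rpow_add hq,
      show p / 2 + -(p / 2 + δ) = -δ by ring, Real.div_rpow hr.le hy0.le,
      Real.rpow_neg hy0.le, div_inv_eq_mul, mul_assoc]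
  rw [hmax]
  calc _ ≤ (r / y) ^ (p / 2) * (1 + B) ^ (p / 2) * (N * r / y) ^ (-(p / 2 + δ)) := by
        have : 0 ≤ (1 + B) ^ (p / 2) := hmid.trans' (by positivity)
        gcongr
    _ = _ := by rw [mul_right_comm, hprod]; ring

lemma Gfun_nonneg {n m : ℕ} {α ε r : ℝ} (hr : 0 < r) (k : ℕ) {u : Fin m → ℝ} {t : ℝ}
    (hu : 0 ≤ u) (ht : 0 ≤ t) : 0 ≤ Gfun n m α ε r k u t := by
  have hs : 0 ≤ (∑ i, u i) + t := add_nonneg (Finset.sum_nonneg fun i _ => hu i) ht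
  unfold Gfun
  refine mul_nonneg (mul_nonneg (mul_nonneg ?_ (le_max_of_le_left ?_)) ?_) ?_ <;> positivity

lemma Gfun_le {n m : ℕ} (hn : 1 ≤ n) (hm : 1 ≤ m) {α ε r : ℝ} (hα : 0 < α) (hα2 : α < 2)
    (hε : 0 < ε) (hr : 0 < r) (k : ℕ) {u : Fin m → ℝ} {t : ℝ}
    (hu : u ∈ Icc (0 : Fin m → ℝ) (fun _ => r ^ α))
    (ht : t ∈ Ioc (r ^ α) (((2 : ℝ) ^ k * r) ^ α)) :
    Gfun n m α ε r k u t ≤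
      (1 + ((m : ℝ) + 1) ^ (1 / α)) ^ ((n : ℝ) / 2) * ((2 : ℝ) ^ k) ^ (-((n : ℝ) / 2 + α / 4))
        * r ^ (-(α / 4)) * t ^ (-(m : ℝ) - 3 / 4) := by
  have hn' : (1 : ℝ) ≤ n := by exact_mod_cast hn
  have hm' : (1 : ℝ) ≤ m := by exact_mod_cast hm
  have hrα : 0 < r ^ α := Real.rpow_pos_of_pos hr α
  have ht0 : 0 < t := hrα.trans ht.1
  have hsum0 : 0 ≤ ∑ i, u i := Finset.sum_nonneg fun i _ => hu.1 i
  have hsum : ∑ i, u i ≤ m * r ^ α := by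
    simpa using Finset.sum_le_sum fun i (_ : i ∈ Finset.univ) => hu.2 i
  unfold Gfun
  set s := (∑ i, u i) + t
  have hts : t ≤ s := by simp only [s]; linarith
  have hs0 : 0 < s := ht0.trans_le hts
  have hsB : s ≤ (m + 1) * ((2 : ℝ) ^ k * r) ^ α := by
    have : (m : ℝ) * r ^ α ≤ m * t := by gcongr; exact ht.1.le
    calc s ≤ (m + 1) * t := by simp only [s]; linarith
      _ ≤ _ := by gcongr; exact ht.2
  have hinv : ∀ x : ℝ, 0 ≤ x → (x ^ α) ^ (1 / α) = x := fun x hx => by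
    rw [one_div, Real.rpow_rpow_inv hx hα.ne']
  have hy : r ≤ s ^ (1 / α) := by
    rw [← hinv r hr.le]
    exact Real.rpow_le_rpow hrα.le (ht.1.le.trans hts) (by positivity)
  have hyB : s ^ (1 / α) ≤ ((m : ℝ) + 1) ^ (1 / α) * ((2 : ℝ) ^ k * r) := by
    rw [← hinv ((2 : ℝ) ^ k * r) (by positivity), ← Real.mul_rpow (by positivity) (by positivity)]
    exact Real.rpow_le_rpow hs0.le hsB (by positivity)
  have key := scale_factors_le (p := n) (by positivity) hε (δ := α / 4) (by positivity)
    (by linarith) hr (by positivity) hy hyB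
  have hyδ : (s ^ (1 / α)) ^ (α / 4) = s ^ (1 / 4 : ℝ) := by
    rw [← Real.rpow_mul hs0.le]
    congr 1
    field_simp
  rw [hyδ] at key
  have hpow : s ^ (-((m : ℝ) + 1)) * s ^ (1 / 4 : ℝ) ≤ t ^ (-(m : ℝ) - 3 / 4) := by
    rw [← Real.rpow_add hs0, show -((m : ℝ) + 1) + 1 / 4 = -(m : ℝ) - 3 / 4 by ring]
    exact Real.rpow_le_rpow_of_nonpos ht0 hts (by linarith)
  rw [mul_assoc, mul_assoc, ← mul_assoc (max _ _)]
  calc _ ≤ _ := mul_le_mul_of_nonneg_left key (Real.rpow_nonneg hs0.le _)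
    _ = (1 + ((m : ℝ) + 1) ^ (1 / α)) ^ ((n : ℝ) / 2)
        * ((2 : ℝ) ^ k) ^ (-((n : ℝ) / 2 + α / 4))
        * r ^ (-(α / 4)) * (s ^ (-((m : ℝ) + 1)) * s ^ (1 / 4 : ℝ)) := by ring
    _ ≤ _ := by gcongr

lemma setIntegral_Gfun_le {n m : ℕ} (hn : 1 ≤ n) (hm : 1 ≤ m) {α ε r : ℝ} (hα : 0 < α)
    (hα2 : α < 2) (hε : 0 < ε) (hr : 0 < r) (k : ℕ) {t : ℝ}
    (ht : t ∈ Ioc (r ^ α) (((2 : ℝ) ^ k * r) ^ α)) :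
    ∫ u in Icc (0 : Fin m → ℝ) (fun _ => r ^ α), Gfun n m α ε r k u t ≤
      (1 + ((m : ℝ) + 1) ^ (1 / α)) ^ ((n : ℝ) / 2) * ((2 : ℝ) ^ k) ^ (-((n : ℝ) / 2 + α / 4))
        * r ^ (-(α / 4)) * (r ^ α) ^ m * t ^ (-(m : ℝ) - 3 / 4) := by
  have hrα : 0 < r ^ α := Real.rpow_pos_of_pos hr α
  have hvol : volume.real (Icc (0 : Fin m → ℝ) (fun _ => r ^ α)) = (r ^ α) ^ m := by
    have h := Real.volume_Icc_pi_toReal (a := (0 : Fin m → ℝ)) (b := fun _ => r ^ α)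
      fun _ => hrα.le
    simpa [Measure.real] using h
  have h := norm_setIntegral_le_of_norm_le_const (μ := volume)
    (s := Icc (0 : Fin m → ℝ) (fun _ => r ^ α)) (f := fun u => Gfun n m α ε r k u t)
    isCompact_Icc.measure_lt_top fun u hu => by
      rw [Real.norm_of_nonneg (Gfun_nonneg hr k hu.1 (hrα.le.trans ht.1.le))]
      exact Gfun_le hn hm hα hα2 hε hr k hu ht
  rw [hvol] at h
  refine (Real.le_norm_self _).trans (h.trans_eq ?_)
  ring

lemma lintegral_Ioi_ofReal_mul_rpow {c p A : ℝ} (hc : 0 ≤ c) (hp : p < -1) (hA : 0 < A) :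
    ∫⁻ t in Ioi A, ENNReal.ofReal (c * t ^ p) = ENNReal.ofReal (c * (-A ^ (p + 1) / (p + 1))) := by
  rw [← integral_Ioi_rpow_of_lt hp hA, ← integral_const_mul,
    ofReal_integral_eq_lintegral_ofReal ((integrableOn_Ioi_rpow_of_lt hp hA).const_mul c)]
  filter_upwards [ae_restrict_mem measurableSet_Ioi] with t ht
  have : 0 < t := hA.trans ht
  positivity

lemma lintegral_setIntegral_Gfun_le {n m : ℕ} (hn : 1 ≤ n) (hm : 1 ≤ m) {α ε r : ℝ} (hα : 0 < α)
    (hα2 : α < 2) (hε : 0 < ε) (hr : 0 < r) (k : ℕ) :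
    ∫⁻ t in Ioc (r ^ α) (((2 : ℝ) ^ k * r) ^ α),
        ENNReal.ofReal (∫ u in Icc (0 : Fin m → ℝ) (fun _ => r ^ α), Gfun n m α ε r k u t) ≤
      ENNReal.ofReal ((1 + ((m : ℝ) + 1) ^ (1 / α)) ^ ((n : ℝ) / 2)
        * ((2 : ℝ) ^ k) ^ (-((n : ℝ) / 2 + α / 4)) / (m - 1 / 4)) := by
  have hm' : (1 : ℝ) ≤ m := by exact_mod_cast hm
  have hrα : 0 < r ^ α := Real.rpow_pos_of_pos hr α
  set K := (1 + ((m : ℝ) + 1) ^ (1 / α)) ^ ((n : ℝ) / 2)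
    * ((2 : ℝ) ^ k) ^ (-((n : ℝ) / 2 + α / 4))
  have hscale : r ^ (-(α / 4)) * (r ^ α) ^ m * (r ^ α) ^ (-(m : ℝ) - 3 / 4 + 1) = 1 := by
    rw [← Real.rpow_natCast, ← Real.rpow_mul hr.le, ← Real.rpow_mul hr.le, ← Real.rpow_add hr,
      ← Real.rpow_add hr]
    convert Real.rpow_zero r using 2
    ring
  calc _ ≤ ∫⁻ t in Ioc (r ^ α) (((2 : ℝ) ^ k * r) ^ α),
          ENNReal.ofReal (K * r ^ (-(α / 4)) * (r ^ α) ^ m * t ^ (-(m : ℝ) - 3 / 4)) :=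
        setLIntegral_mono' measurableSet_Ioc fun t ht =>
          ENNReal.ofReal_le_ofReal (setIntegral_Gfun_le hn hm hα hα2 hε hr k ht)
    _ ≤ ∫⁻ t in Ioi (r ^ α),
          ENNReal.ofReal (K * r ^ (-(α / 4)) * (r ^ α) ^ m * t ^ (-(m : ℝ) - 3 / 4)) :=
        lintegral_mono_set Ioc_subset_Ioi_self
    _ = ENNReal.ofReal (K / (m - 1 / 4)) := by
        rw [lintegral_Ioi_ofReal_mul_rpow (by positivity) (by linarith) hrα]
        congr 1
        rw [show -(m : ℝ) - 3 / 4 + 1 = -(m - 1 / 4) by ring, neg_div_neg_eq, ← mul_div_assoc]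
        rw [show -(m : ℝ) - 3 / 4 + 1 = -(m - 1 / 4) by ring] at hscale
        congr 1
        linear_combination K * hscale

theorem statement18 (n : ℕ) (hn : 1 ≤ n) (α ε : ℝ) (hα : 0 < α) (hα2 : α < 2) (hε : 0 < ε)
    (m : ℕ) (hm : 1 ≤ m) :
    ∃ C : ℝ, 0 < C ∧
      ∀ r : ℝ, 0 < r →
        (∑' k : ℕ, (2 : ℝ≥0∞) ^ ((((k : ℝ) + 2) * n) / 2) *
            ∫⁻ t in Ioc (r ^ α) (((2 : ℝ) ^ (k + 2) * r) ^ α),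
              ENNReal.ofReal
                (∫ u in Icc (0 : Fin m → ℝ) (fun _ => r ^ α), Gfun n m α ε r (k + 2) u t))
          ≤ ENNReal.ofReal C := by
  have hm' : (1 : ℝ) ≤ m := by exact_mod_cast hm
  have hm0 : (0 : ℝ) < m - 1 / 4 := by linarith
  set K := (1 + ((m : ℝ) + 1) ^ (1 / α)) ^ ((n : ℝ) / 2) / (m - 1 / 4) with hK
  have hK0 : 0 < K := by positivity
  set q : ℝ := 2 ^ (-(α / 4)) with hq
  have hq0 : 0 < q := by positivity
  have hq1 : q < 1 := Real.rpow_lt_one_of_one_lt_of_neg one_lt_two (by linarith)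
  have hsummable : Summable fun k : ℕ => K * q ^ 2 * q ^ k :=
    (summable_geometric_of_lt_one hq0.le hq1).mul_left _
  refine ⟨∑' k : ℕ, K * q ^ 2 * q ^ k,
    hsummable.tsum_pos (fun k => by positivity) 0 (by positivity), fun r hr => ?_⟩
  rw [ENNReal.ofReal_tsum_of_nonneg (fun k => by positivity) hsummable]
  refine ENNReal.tsum_le_tsum fun k => ?_
  refine (mul_le_mul_right (lintegral_setIntegral_Gfun_le hn hm hα hα2 hε hr (k + 2)) _).trans_eq ?_
  rw [← ENNReal.ofReal_ofNat 2, ENNReal.ofReal_rpow_of_pos two_pos,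
    ← ENNReal.ofReal_mul (by positivity)]
  congr 1
  have hpow : (2 : ℝ) ^ (((k : ℝ) + 2) * n / 2) * ((2 : ℝ) ^ (k + 2)) ^ (-((n : ℝ) / 2 + α / 4))
      = q ^ 2 * q ^ k := by
    rw [← pow_add, hq, ← Real.rpow_natCast 2, ← Real.rpow_natCast (2 ^ _),
      ← Real.rpow_mul two_pos.le, ← Real.rpow_mul two_pos.le, ← Real.rpow_add two_pos]
    congr 1
    push_cast
    ring
  rw [mul_assoc K, ← hpow, hK]
  ring
end
end
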